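/- arXiv:2301.05674 — 2 statements merged into one kernel-verified Lean document; each statement's English description precedes it below -/
import Mathlib

section
/- Sum-based altruistic-treatment preferences are type-I-monotonic and type-II-monotonic: let G be a network of friends on N = {1,…,n} with M ≥ n³, let i ∈ N, let j ∈ E_i, let Γ, Δ be coalition structures on N with v_j(Γ) ≥ v_j(Δ), and let G' be the graph obtained from G by adding the edge {i,j}; write u' for the sum-based altruistic-treatment utility in G'. If j ∈ Γ(i) ∩ Δ(i) or j ∈ Γ(i) \ Δ(i), then u^sumAL_i(Γ) > u^sumAL_i(Δ) implies u'^sumAL_i(Γ) > u'^sumAL_i(Δ), and u^sumAL_i(Γ) = u^sumAL_i(Δ) implies u'^sumAL_i(Γ) ≥ u'^sumAL_i(Δ). -/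
namespace ACFG

/-- A coalition structure on the player set `Fin n` (the players `1,…,n`), represented by
the map sending each player to her coalition (her block of the partition). -/
structure CoalitionStructure (n : ℕ) where
  block : Fin n → Finset (Fin n)
  mem_block : ∀ i, i ∈ block i
  block_eq : ∀ i j, j ∈ block i → block j = block i

variable {n : ℕ}

/-- The set `F_i` of friends of player `i` in the network of friends `G`. -/
def friends (G : SimpleGraph (Fin n)) [DecidableRel G.Adj] (i : Fin n) : Finset (Fin n) :=
  Finset.univ.filter (fun j => G.Adj i j)

/-- The set `E_i` of enemies of player `i`: all players other than `i` and her friends. -/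
def enemies (G : SimpleGraph (Fin n)) [DecidableRel G.Adj] (i : Fin n) : Finset (Fin n) :=
  (insert i (friends G i))ᶜ

/-- The friend-oriented value of player `i` for the coalition structure `Γ`:
`v_i(Γ) = n·|Γ(i) ∩ F_i| − |Γ(i) ∩ E_i|`. -/
def val (G : SimpleGraph (Fin n)) [DecidableRel G.Adj] (Γ : CoalitionStructure n)
    (i : Fin n) : ℤ :=
  (n : ℤ) * ((Γ.block i ∩ friends G i).card : ℤ) - ((Γ.block i ∩ enemies G i).card : ℤ)

/-- `sumF_i(Γ)`: the sum of the values of `i`'s friends. -/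
def sumF (G : SimpleGraph (Fin n)) [DecidableRel G.Adj] (Γ : CoalitionStructure n)
    (i : Fin n) : ℤ :=
  ∑ f ∈ friends G i, val G Γ f

/-- `sumF+_i(Γ)`: the sum of the values of `i`'s friends and of `i` herself. -/
def sumFplus (G : SimpleGraph (Fin n)) [DecidableRel G.Adj] (Γ : CoalitionStructure n)
    (i : Fin n) : ℤ :=
  ∑ f ∈ insert i (friends G i), val G Γ f

/-- `minF_i(Γ)`: the minimum of the values of `i`'s friends (`0` if `i` has no friends). -/
def minF (G : SimpleGraph (Fin n)) [DecidableRel G.Adj] (Γ : CoalitionStructure n)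
    (i : Fin n) : ℤ :=
  if h : (friends G i).Nonempty then (friends G i).inf' h (val G Γ) else 0

/-- `minF+_i(Γ)`: the minimum of the values of `i`'s friends and of `i` herself. -/
def minFplus (G : SimpleGraph (Fin n)) [DecidableRel G.Adj] (Γ : CoalitionStructure n)
    (i : Fin n) : ℤ :=
  (insert i (friends G i)).inf' (Finset.insert_nonempty _ _) (val G Γ)

/-- Sum-based selfish-first utility: `u^sumSF_i(Γ) = M·v_i(Γ) + sumF_i(Γ)`. -/
def usumSF (G : SimpleGraph (Fin n)) [DecidableRel G.Adj] (M : ℤ) (Γ : CoalitionStructure n)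
    (i : Fin n) : ℤ :=
  M * val G Γ i + sumF G Γ i

/-- Sum-based equal-treatment utility: `u^sumEQ_i(Γ) = sumF+_i(Γ)`. -/
def usumEQ (G : SimpleGraph (Fin n)) [DecidableRel G.Adj] (Γ : CoalitionStructure n)
    (i : Fin n) : ℤ :=
  sumFplus G Γ i

/-- Sum-based altruistic-treatment utility: `u^sumAL_i(Γ) = v_i(Γ) + M·sumF_i(Γ)`. -/
def usumAL (G : SimpleGraph (Fin n)) [DecidableRel G.Adj] (M : ℤ) (Γ : CoalitionStructure n)
    (i : Fin n) : ℤ :=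
  val G Γ i + M * sumF G Γ i

/-- Min-based selfish-first utility: `u^minSF_i(Γ) = M·v_i(Γ) + minF_i(Γ)`. -/
def uminSF (G : SimpleGraph (Fin n)) [DecidableRel G.Adj] (M : ℤ) (Γ : CoalitionStructure n)
    (i : Fin n) : ℤ :=
  M * val G Γ i + minF G Γ i

/-- Min-based equal-treatment utility: `u^minEQ_i(Γ) = minF+_i(Γ)`. -/
def uminEQ (G : SimpleGraph (Fin n)) [DecidableRel G.Adj] (Γ : CoalitionStructure n)
    (i : Fin n) : ℤ :=
  minFplus G Γ i

/-- Min-based altruistic-treatment utility: `u^minAL_i(Γ) = v_i(Γ) + M·minF_i(Γ)`. -/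
def uminAL (G : SimpleGraph (Fin n)) [DecidableRel G.Adj] (M : ℤ) (Γ : CoalitionStructure n)
    (i : Fin n) : ℤ :=
  val G Γ i + M * minF G Γ i

/-- The graph `G'` obtained from `G` by adding the edge `{i, j}`. -/
def addEdge (G : SimpleGraph (Fin n)) (i j : Fin n) : SimpleGraph (Fin n) :=
  G ⊔ SimpleGraph.fromEdgeSet {s(i, j)}

instance (G : SimpleGraph (Fin n)) [DecidableRel G.Adj] (i j : Fin n) :
    DecidableRel (addEdge G i j).Adj := fun a b =>
  decidable_of_iff (G.Adj a b ∨ (s(a, b) = s(i, j) ∧ a ≠ b)) (by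
    simp [addEdge, SimpleGraph.fromEdgeSet_adj])

theorem mem_enemies {G : SimpleGraph (Fin n)} [DecidableRel G.Adj] {i j : Fin n} :
    j ∈ enemies G i ↔ j ≠ i ∧ ¬ G.Adj i j := by
  simp [enemies, friends]

theorem CoalitionStructure.mem_block_comm (Γ : CoalitionStructure n) {i j : Fin n} :
    i ∈ Γ.block j ↔ j ∈ Γ.block i :=
  ⟨fun h => Γ.block_eq j i h ▸ Γ.mem_block j, fun h => Γ.block_eq i j h ▸ Γ.mem_block i⟩

theorem val_congr {G H : SimpleGraph (Fin n)} [DecidableRel G.Adj] [DecidableRel H.Adj]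
    {i : Fin n} (h : friends H i = friends G i) (Γ : CoalitionStructure n) :
    val H Γ i = val G Γ i := by
  simp only [val, enemies, h]

/-- Turning an enemy `j` of `i` into a friend raises the value of `i` by `n + 1` if `j` belongs
to the coalition of `i`, and leaves it unchanged otherwise. -/
theorem val_of_friends_eq_insert {G H : SimpleGraph (Fin n)} [DecidableRel G.Adj]
    [DecidableRel H.Adj] {i j : Fin n} (hj : j ∈ enemies G i)
    (h : friends H i = insert j (friends G i)) (Γ : CoalitionStructure n) :
    val H Γ i = val G Γ i + if j ∈ Γ.block i then (n : ℤ) + 1 else 0 := by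
  have hjF : j ∉ friends G i := by simpa [friends] using (mem_enemies.1 hj).2
  have hE : enemies H i = (enemies G i).erase j := by
    ext k
    simp only [enemies, h, Finset.mem_compl, Finset.mem_insert, Finset.mem_erase]
    tauto
  unfold val
  rw [h, hE, Finset.inter_erase]
  split_ifs with hb
  · rw [Finset.inter_insert_of_mem hb, Finset.card_insert_of_notMem (by simp [hjF]),
      ← Finset.card_erase_add_one (Finset.mem_inter.2 ⟨hb, hj⟩)]
    push_cast
    ring
  · rw [Finset.inter_insert_of_notMem hb, Finset.erase_eq_of_notMem (by simp [hb]), add_zero]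

theorem addEdge_adj {G : SimpleGraph (Fin n)} {i j a b : Fin n} :
    (addEdge G i j).Adj a b ↔ G.Adj a b ∨ (s(a, b) = s(i, j) ∧ a ≠ b) := by
  simp [addEdge, SimpleGraph.fromEdgeSet_adj]

section AddEdge

variable (G : SimpleGraph (Fin n)) [DecidableRel G.Adj] {i j : Fin n}

theorem friends_addEdge_left (hij : j ≠ i) :
    friends (addEdge G i j) i = insert j (friends G i) := by
  ext k
  simp only [friends, Finset.mem_filter, Finset.mem_univ, true_and, Finset.mem_insert,
    addEdge_adj, Sym2.eq_iff]
  grind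

theorem friends_addEdge_right (hij : j ≠ i) :
    friends (addEdge G i j) j = insert i (friends G j) := by
  ext k
  simp only [friends, Finset.mem_filter, Finset.mem_univ, true_and, Finset.mem_insert,
    addEdge_adj, Sym2.eq_iff]
  grind

theorem friends_addEdge_of_ne {k : Fin n} (hi : k ≠ i) (hj : k ≠ j) :
    friends (addEdge G i j) k = friends G k := by
  ext l
  simp only [friends, Finset.mem_filter, Finset.mem_univ, true_and, addEdge_adj, Sym2.eq_iff]
  grind

variable {G}

theorem sumF_addEdge (hj : j ∈ enemies G i) (Γ : CoalitionStructure n) :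
    sumF (addEdge G i j) Γ i =
      sumF G Γ i + (val G Γ j + if j ∈ Γ.block i then (n : ℤ) + 1 else 0) := by
  obtain ⟨hij, hadj⟩ := mem_enemies.1 hj
  have hi : i ∈ enemies G j := mem_enemies.2 ⟨hij.symm, fun h => hadj h.symm⟩
  have hsum : ∑ f ∈ friends G i, val (addEdge G i j) Γ f = ∑ f ∈ friends G i, val G Γ f := by
    refine Finset.sum_congr rfl fun f hf => val_congr ?_ Γ
    have hf : G.Adj i f := by simpa [friends] using hf
    exact friends_addEdge_of_ne G hf.ne' (by rintro rfl; exact hadj hf)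
  rw [sumF, sumF, friends_addEdge_left G hij, Finset.sum_insert (by simpa [friends] using hadj),
    hsum, val_of_friends_eq_insert hi (friends_addEdge_right G hij)]
  simp only [Γ.mem_block_comm (i := i)]
  ring

theorem usumAL_addEdge (M : ℤ) (hj : j ∈ enemies G i) (Γ : CoalitionStructure n) :
    usumAL (addEdge G i j) M Γ i =
      usumAL G M Γ i + M * val G Γ j + (M + 1) * if j ∈ Γ.block i then (n : ℤ) + 1 else 0 := by
  rw [usumAL, usumAL, sumF_addEdge hj,
    val_of_friends_eq_insert hj (friends_addEdge_left G (mem_enemies.1 hj).1)]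
  ring

end AddEdge

/-- Sum-based altruistic-treatment preferences are type-I- and
type-II-monotonic: if the enemy `j` of `i` satisfies `j ∈ Γ(i) ∩ Δ(i)` (type I) or
`j ∈ Γ(i) \ Δ(i)` (type II) and `v_j(Γ) ≥ v_j(Δ)`, then turning `j` into a friend of `i`
preserves `i`'s strict preference of `Γ` over `Δ`, and turns indifference into weak
preference (for `M ≥ n³`). -/
theorem sumAL_monotonic (G : SimpleGraph (Fin n)) [DecidableRel G.Adj] (M : ℤ)
    (hM : (n : ℤ) ^ 3 ≤ M) (i j : Fin n) (hj : j ∈ enemies G i)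
    (Γ Δ : CoalitionStructure n) (hv : val G Δ j ≤ val G Γ j)
    (hcase : (j ∈ Γ.block i ∧ j ∈ Δ.block i) ∨ (j ∈ Γ.block i ∧ j ∉ Δ.block i)) :
    (usumAL G M Δ i < usumAL G M Γ i →
        usumAL (addEdge G i j) M Δ i < usumAL (addEdge G i j) M Γ i) ∧
      (usumAL G M Γ i = usumAL G M Δ i →
        usumAL (addEdge G i j) M Δ i ≤ usumAL (addEdge G i j) M Γ i) := by
  have hM0 : 0 ≤ M := le_trans (by positivity) hM
  have hΓ : j ∈ Γ.block i := hcase.elim And.left And.left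
  have hval : M * val G Δ j ≤ M * val G Γ j := mul_le_mul_of_nonneg_left hv hM0
  have hbonus : (M + 1) * (if j ∈ Δ.block i then (n : ℤ) + 1 else 0) ≤ (M + 1) * (n + 1) := by
    refine mul_le_mul_of_nonneg_left ?_ (by positivity)
    split_ifs
    · exact le_rfl
    · positivity
  rw [usumAL_addEdge M hj, usumAL_addEdge M hj, if_pos hΓ]
  constructor <;> intro h <;> linarith

end ACFG
end

section
/- Characterization of perfect coalition structures under selfish-first preferences: let G be a network of friends on N = {1,…,n} with M ≥ n³, and let Γ be a coalition structure on N. Then Γ is perfect under the sum-based selfish-first preferences given by u^sumSF (equivalently, under the min-based selfish-first preferences given by u^minSF) — i.e., u_i(Γ) ≥ u_i(Δ) for every player i ∈ N and every coalition structure Δ on N — if and only if the coalitions of Γ are exactly the vertex sets of the connected components of G and every such component is a clique. Consequently, a perfect coalition structure exists for G under these preferences if and only if every connected component of G is a clique. -/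
namespace ACFG

variable {n : ℕ}

/-- `Γ` is perfect under the utility `u` if no player prefers any coalition structure
to `Γ`. -/
def Perfect (u : CoalitionStructure n → Fin n → ℤ) (Γ : CoalitionStructure n) : Prop :=
  ∀ (i : Fin n) (Δ : CoalitionStructure n), u Δ i ≤ u Γ i

section Characterization

variable {G : SimpleGraph (Fin n)} [DecidableRel G.Adj]

@[simp] lemma mem_friends {i j : Fin n} : j ∈ friends G i ↔ G.Adj i j := by
  simp [friends]

lemma card_friends_lt (i : Fin n) : (friends G i).card < n := by
  have h : friends G i ⊂ Finset.univ :=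
    Finset.ssubset_univ_iff.2 fun h => by
      have : i ∈ friends G i := h ▸ Finset.mem_univ i
      simp at this
  simpa using Finset.card_lt_card h

lemma val_le (Γ : CoalitionStructure n) (i : Fin n) :
    val G Γ i ≤ n * (friends G i).card := by
  have h : ((Γ.block i ∩ friends G i).card : ℤ) ≤ (friends G i).card :=
    mod_cast Finset.card_le_card Finset.inter_subset_right
  unfold val
  nlinarith

lemma val_le_sq (Γ : CoalitionStructure n) (i : Fin n) : val G Γ i ≤ (n : ℤ) ^ 2 := by
  have h := val_le (G := G) Γ i
  have h' : ((friends G i).card : ℤ) < n := mod_cast card_friends_lt i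
  nlinarith

lemma val_eq_iff (Γ : CoalitionStructure n) (i : Fin n) :
    val G Γ i = n * (friends G i).card ↔ Γ.block i = insert i (friends G i) := by
  have hi := Γ.mem_block i
  constructor
  · intro h
    have hn : (0 : ℤ) < n := mod_cast i.pos
    have hc : ((Γ.block i ∩ friends G i).card : ℤ) ≤ (friends G i).card :=
      mod_cast Finset.card_le_card Finset.inter_subset_right
    unfold val at h
    have hF : (Γ.block i ∩ friends G i).card = (friends G i).card := by
      have : ((Γ.block i ∩ friends G i).card : ℤ) = (friends G i).card := by nlinarith
      exact_mod_cast this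
    have hE : (Γ.block i ∩ enemies G i).card = 0 := by
      rw [hF] at h
      omega
    have hF' := Finset.eq_of_subset_of_card_le Finset.inter_subset_right hF.ge
    rw [Finset.inter_eq_right] at hF'
    rw [Finset.card_eq_zero, enemies, ← Finset.sdiff_eq_inter_compl,
      Finset.sdiff_eq_empty_iff_subset] at hE
    exact hE.antisymm (Finset.insert_subset hi hF')
  · intro h
    rw [val, h, enemies, Finset.inter_compl,
      Finset.inter_eq_right.2 (Finset.subset_insert _ _)]
    simp

/-- The coalition structure in which `S` is a coalition and all other players are alone. -/
def CoalitionStructure.ofFinset (S : Finset (Fin n)) : CoalitionStructure n where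
  block i := if i ∈ S then S else {i}
  mem_block i := by split_ifs <;> simp [*]
  block_eq i j := by
    by_cases hi : i ∈ S
    · simp +contextual [hi]
    · simp +contextual [hi]

lemma val_nonneg_of_adj_mem {Γ : CoalitionStructure n} {i j : Fin n} (hij : G.Adj i j)
    (hj : j ∈ Γ.block i) : 0 ≤ val G Γ i := by
  have hF : (1 : ℤ) ≤ (Γ.block i ∩ friends G i).card := by
    exact_mod_cast Finset.card_pos.2 ⟨j, by simp [hj, hij]⟩
  have hE : ((Γ.block i ∩ enemies G i).card : ℤ) ≤ n := by
    exact_mod_cast (Finset.card_le_univ _).trans_eq (Fintype.card_fin n)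
  unfold val
  nlinarith

lemma block_eq_insert_friends_iff (Γ : CoalitionStructure n) :
    (∀ i, Γ.block i = insert i (friends G i)) ↔
      (∀ i j : Fin n, j ∈ Γ.block i ↔ G.Reachable i j) ∧
        ∀ i : Fin n, G.IsClique (Γ.block i : Set (Fin n)) := by
  constructor
  · intro h
    refine ⟨fun i j => ⟨fun hj => ?_, fun hij => ?_⟩, fun i j hj k hk hjk => ?_⟩
    · rw [h, Finset.mem_insert, mem_friends] at hj
      rcases hj with rfl | hj
      · exact .refl _
      · exact hj.reachable
    · obtain ⟨w⟩ := hij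
      induction w with
      | nil => exact Γ.mem_block _
      | @cons a b c hab _ ih => rwa [← Γ.block_eq a b (by simp [h, hab])]
    · rw [Finset.mem_coe] at hj hk
      rw [← Γ.block_eq i j hj, h, Finset.mem_insert, mem_friends] at hk
      exact hk.resolve_left (Ne.symm hjk)
  · rintro ⟨hR, hC⟩ i
    ext j
    rw [Finset.mem_insert, mem_friends]
    constructor
    · intro hj
      by_cases hij : j = i
      · exact .inl hij
      · exact .inr (hC i (Γ.mem_block i) hj (Ne.symm hij))
    · rintro (rfl | hj)
      · exact Γ.mem_block _
      · exact (hR i j).2 hj.reachable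

/-- Selfish-first utilities whose altruistic part `A` is monotone in the friends' values and
too small to outweigh the player's own value make exactly those structures perfect in which
every player is together with precisely her friends. -/
lemma perfect_selfishFirst_iff {M : ℤ} (hM : (n : ℤ) ^ 3 ≤ M)
    {A : CoalitionStructure n → Fin n → ℤ} (hlt : ∀ Γ i, A Γ i < (n : ℤ) ^ 3)
    (hnonneg : ∀ Γ i, (∀ f ∈ friends G i, 0 ≤ val G Γ f) → 0 ≤ A Γ i)
    (hmono : ∀ Γ Δ i, (∀ f ∈ friends G i, val G Δ f ≤ val G Γ f) → A Δ i ≤ A Γ i)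
    (Γ : CoalitionStructure n) :
    Perfect (fun Γ i => M * val G Γ i + A Γ i) Γ ↔
      ∀ i, Γ.block i = insert i (friends G i) := by
  have hM0 : 0 ≤ M := le_trans (by positivity) hM
  constructor
  · intro h i
    rw [← val_eq_iff]
    set Δ := CoalitionStructure.ofFinset (insert i (friends G i)) with hΔ
    have hval : val G Δ i = n * (friends G i).card := by
      rw [val_eq_iff]
      simp [hΔ, CoalitionStructure.ofFinset]
    have hA : 0 ≤ A Δ i := hnonneg Δ i fun f hf => by
      refine val_nonneg_of_adj_mem (mem_friends.1 hf).symm ?_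
      simp [hΔ, CoalitionStructure.ofFinset, mem_friends.1 hf]
    have hle := h i Δ
    have hA' := hlt Γ i
    simp only [hval] at hle
    by_contra hne
    have hlt' : val G Γ i + 1 ≤ n * (friends G i).card := lt_of_le_of_ne (val_le Γ i) hne
    nlinarith [mul_le_mul_of_nonneg_left hlt' hM0]
  · intro h i Δ
    have hmax (j : Fin n) : val G Δ j ≤ val G Γ j :=
      (val_le Δ j).trans_eq ((val_eq_iff Γ j).2 (h j)).symm
    exact add_le_add (mul_le_mul_of_nonneg_left (hmax i) hM0) (hmono Γ Δ i fun f _ => hmax f)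

lemma perfect_usumSF_iff {M : ℤ} (hM : (n : ℤ) ^ 3 ≤ M) (Γ : CoalitionStructure n) :
    Perfect (usumSF G M) Γ ↔ ∀ i, Γ.block i = insert i (friends G i) := by
  refine perfect_selfishFirst_iff hM (A := sumF G) (fun Γ i => ?_)
    (fun Γ i => Finset.sum_nonneg) (fun Γ Δ i => Finset.sum_le_sum) Γ
  have h : sumF G Γ i ≤ (friends G i).card * (n : ℤ) ^ 2 := by
    simpa [sumF] using Finset.sum_le_card_nsmul _ _ _ fun f (_ : f ∈ friends G i) => val_le_sq Γ f
  have hn : (0 : ℤ) < n := mod_cast i.pos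
  have hcard : ((friends G i).card : ℤ) < n := mod_cast card_friends_lt i
  calc sumF G Γ i ≤ (friends G i).card * (n : ℤ) ^ 2 := h
    _ < n * (n : ℤ) ^ 2 := by gcongr
    _ = (n : ℤ) ^ 3 := by ring

lemma perfect_uminSF_iff {M : ℤ} (hM : (n : ℤ) ^ 3 ≤ M) (Γ : CoalitionStructure n) :
    Perfect (uminSF G M) Γ ↔ ∀ i, Γ.block i = insert i (friends G i) := by
  refine perfect_selfishFirst_iff hM (A := minF G) (fun Γ i => ?_)
    (fun Γ i h => ?_) (fun Γ Δ i h => ?_) Γ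
  · have hn : (0 : ℤ) < n := mod_cast i.pos
    unfold minF
    split_ifs with hF
    · obtain ⟨f, hf⟩ := hF
      have hif : f ≠ i := (mem_friends.1 hf).ne'
      have hn2 : (1 : ℤ) < n := by
        have := f.isLt
        have := i.isLt
        have : (f : ℕ) ≠ i := Fin.val_ne_of_ne hif
        omega
      calc (friends G i).inf' ⟨f, hf⟩ (val G Γ) ≤ val G Γ f := Finset.inf'_le _ hf
        _ ≤ (n : ℤ) ^ 2 := val_le_sq Γ f
        _ < (n : ℤ) ^ 3 := pow_lt_pow_right₀ hn2 (by norm_num)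
    · positivity
  · unfold minF
    split_ifs with hF
    · exact Finset.le_inf' _ _ h
    · exact le_rfl
  · unfold minF
    split_ifs with hF
    · exact Finset.le_inf' _ _ fun f hf => (Finset.inf'_le _ hf).trans (h f hf)
    · exact le_rfl

lemma exists_block_eq_insert_friends_iff :
    (∃ Γ : CoalitionStructure n, ∀ i, Γ.block i = insert i (friends G i)) ↔
      ∀ i j : Fin n, G.Reachable i j → i = j ∨ G.Adj i j := by
  constructor
  · rintro ⟨Γ, h⟩ i j hij
    have hj := (((block_eq_insert_friends_iff Γ).1 h).1 i j).2 hij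
    rw [h, Finset.mem_insert, mem_friends] at hj
    exact hj.imp_left Eq.symm
  · intro h
    have hmem (i j : Fin n) : j ∈ insert i (friends G i) ↔ G.Reachable i j := by
      rw [Finset.mem_insert, mem_friends]
      refine ⟨?_, fun hij => (h i j hij).imp_left Eq.symm⟩
      rintro (rfl | hij)
      · exact .refl _
      · exact hij.reachable
    refine ⟨⟨fun i => insert i (friends G i), fun i => Finset.mem_insert_self _ _,
      fun i j hj => ?_⟩, fun i => rfl⟩
    rw [hmem] at hj
    ext k
    rw [hmem, hmem]
    exact ⟨hj.trans, hj.symm.trans⟩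

end Characterization

/-- **characterization of perfect coalition structures under selfish-first
preferences.** For `M ≥ n³`, a coalition structure `Γ` is perfect under the sum-based
(equivalently, the min-based) selfish-first preferences if and only if its coalitions are
exactly the vertex sets of the connected components of `G` and every component is a
clique.  Consequently, a perfect coalition structure exists if and only if every
connected component of `G` is a clique. -/
theorem perfect_iff_components_and_cliques (G : SimpleGraph (Fin n)) [DecidableRel G.Adj]
    (M : ℤ) (hM : (n : ℤ) ^ 3 ≤ M) (Γ : CoalitionStructure n) :
    (Perfect (usumSF G M) Γ ↔
        (∀ i j : Fin n, j ∈ Γ.block i ↔ G.Reachable i j) ∧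
          ∀ i : Fin n, G.IsClique (Γ.block i : Set (Fin n))) ∧
      (Perfect (uminSF G M) Γ ↔
        (∀ i j : Fin n, j ∈ Γ.block i ↔ G.Reachable i j) ∧
          ∀ i : Fin n, G.IsClique (Γ.block i : Set (Fin n))) ∧
      ((∃ Γ' : CoalitionStructure n, Perfect (usumSF G M) Γ') ↔
        ∀ i j : Fin n, G.Reachable i j → i = j ∨ G.Adj i j) ∧
      ((∃ Γ' : CoalitionStructure n, Perfect (uminSF G M) Γ') ↔
        ∀ i j : Fin n, G.Reachable i j → i = j ∨ G.Adj i j) := by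
  simp only [perfect_usumSF_iff hM, perfect_uminSF_iff hM]
  exact ⟨block_eq_insert_friends_iff Γ, block_eq_insert_friends_iff Γ,
    exists_block_eq_insert_friends_iff, exists_block_eq_insert_friends_iff⟩

end ACFG
end
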